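/- Let S_0 = 0, S_n = X_1 + … + X_n be a random walk with i.i.d. increments which is oscillating, i.e., limsup_n S_n = +∞ and liminf_n S_n = −∞ almost surely. Define u(x) := 1 + Σ_{k=1}^∞ P(−S_k ≤ x, M_k < 0) for x ≥ 0 (where M_k = max(S_1,…,S_k)), and u(x) = 0 for x < 0. Then u satisfies the harmonicity identity E[u(x + X); x + X ≥ 0] = u(x) for all x ≥ 0, where X is distributed as X_1. -/

import Mathlib

open MeasureTheory ProbabilityTheory Filter Set Topology

noncomputable section

namespace BPREpaper

variable {Ω : Type*} [MeasurableSpace Ω]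

/-- The random walk `S n = X 1 + ... + X n` (increments indexed from `1`, `S 0 = 0`). -/
def walk (X : ℕ → Ω → ℝ) (n : ℕ) (ω : Ω) : ℝ := ∑ i ∈ Finset.Icc 1 n, X i ω

/-- `Mwalk X n = max (S 1, ..., S n)` for `n ≥ 1` (junk value `0` for `n = 0`). -/
def Mwalk (X : ℕ → Ω → ℝ) : ℕ → Ω → ℝ
  | 0, _ => 0
  | n + 1, ω =>
      (Finset.Icc 1 (n + 1)).sup' (Finset.nonempty_Icc.mpr (by omega)) fun i => walk X i ω

/-- `Lwalk X n = min (S 1, ..., S n)` for `n ≥ 1` (junk value `0` for `n = 0`). -/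
def Lwalk (X : ℕ → Ω → ℝ) : ℕ → Ω → ℝ
  | 0, _ => 0
  | n + 1, ω =>
      (Finset.Icc 1 (n + 1)).inf' (Finset.nonempty_Icc.mpr (by omega)) fun i => walk X i ω

/-- minimum of `S 0, S 1, ..., S n`. -/
def minWalk (X : ℕ → Ω → ℝ) (n : ℕ) (ω : Ω) : ℝ :=
  (Finset.range (n + 1)).inf' (by simp) fun i => walk X i ω

/-- `τ(n)`: the first moment at which the minimum of `S 0, ..., S n` is attained. -/
def tauWalk (X : ℕ → Ω → ℝ) (n : ℕ) (ω : Ω) : ℕ :=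
  sInf {i : ℕ | walk X i ω = minWalk X n ω}

/-- The renewal function `u(x) = 1 + ∑_{k ≥ 1} P(-S_k ≤ x, M_k < 0)` for `x ≥ 0`,
`u(x) = 0` for `x < 0`. -/
def uFun (μ : Measure Ω) (X : ℕ → Ω → ℝ) (x : ℝ) : ℝ :=
  if 0 ≤ x then
    1 + ∑' k : ℕ, (μ {ω | -walk X (k + 1) ω ≤ x ∧ Mwalk X (k + 1) ω < 0}).toReal
  else 0

/-- The renewal function `v(x) = 1 + ∑_{k ≥ 1} P(-S_k > x, L_k ≥ 0)` for `x ≤ 0`,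
`v(x) = 0` for `x > 0`. -/
def vFun (μ : Measure Ω) (X : ℕ → Ω → ℝ) (x : ℝ) : ℝ :=
  if x ≤ 0 then
    1 + ∑' k : ℕ, (μ {ω | x < -walk X (k + 1) ω ∧ 0 ≤ Lwalk X (k + 1) ω}).toReal
  else 0

/-- The event `{∀ 1 ≤ i ≤ n, x + S_i ≥ 0} = {L_n ≥ 0}` for the walk started at `x`. -/
def posSet (X : ℕ → Ω → ℝ) (x : ℝ) (n : ℕ) : Set Ω :=
  {ω | ∀ i ∈ Finset.Icc 1 n, 0 ≤ x + walk X i ω}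

/-- The event `{∀ 1 ≤ i ≤ n, x + S_i < 0} = {M_n < 0}` for the walk started at `x`. -/
def negSet (X : ℕ → Ω → ℝ) (x : ℝ) (n : ℕ) : Set Ω :=
  {ω | ∀ i ∈ Finset.Icc 1 n, x + walk X i ω < 0}

/-- A distribution on `ℝ` is non-lattice: it is not concentrated on any arithmetic
progression `a + hℤ`. -/
def NonLattice (ν : Measure ℝ) : Prop :=
  ¬ ∃ a h : ℝ, ν {x | ∃ k : ℤ, x = a + k * h} = 1

/-- `ν` is an `α`-stable law on `ℝ`. -/
def IsStableLaw (α : ℝ) (ν : Measure ℝ) : Prop :=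
  ∀ a b : ℝ, 0 < a → 0 < b → ∃ c d : ℝ, 0 < c ∧ a ^ α + b ^ α = c ^ α ∧
    ((ν.map (fun x => a * x)).prod (ν.map (fun x => b * x))).map (fun p : ℝ × ℝ => p.1 + p.2)
      = ν.map (fun x => c * x + d)

/-- Weak convergence of a sequence of laws on `ℝ`, tested against bounded continuous
functions. -/
def WeakTendsto (μs : ℕ → Measure ℝ) (ν : Measure ℝ) : Prop :=
  ∀ g : BoundedContinuousFunction ℝ ℝ,
    Tendsto (fun n => ∫ x, g x ∂(μs n)) atTop (𝓝 (∫ x, g x ∂ν))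

/-- Assumption A4: there are norming constants `c n → ∞` such that `S n / c n` converges in
distribution to an `α`-stable law concentrated neither on `[0,∞)` nor on `(-∞,0]`; the
increment distribution is non-lattice. -/
def AssumptionA4 (μ : Measure Ω) (X : ℕ → Ω → ℝ) (c : ℕ → ℝ) : Prop :=
  Tendsto c atTop atTop ∧ NonLattice (μ.map (X 1)) ∧
    ∃ (α : ℝ) (ν : Measure ℝ), IsProbabilityMeasure ν ∧ IsStableLaw α ν ∧
      0 < ν (Set.Iio 0) ∧ 0 < ν (Set.Ioi 0) ∧
      WeakTendsto (fun n => μ.map fun ω => walk X n ω / c n) ν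

/-- A family of random elements indexed by `ι` which is i.i.d. (the common distribution
being that of the element with index `i0`). -/
def IIDfam {ι : Type*} {E : Type*} [MeasurableSpace E] (μ : Measure Ω) (Q : ι → Ω → E)
    (i0 : ι) : Prop :=
  (∀ i, Measurable (Q i)) ∧ iIndepFun Q μ ∧
    ∀ i, IdentDistrib (Q i) (Q i0) μ μ

/-- An i.i.d. sequence indexed by `ℕ` (indices from `1` are the relevant ones). -/
def IIDseq {E : Type*} [MeasurableSpace E] (μ : Measure Ω) (Q : ℕ → Ω → E) : Prop :=
  IIDfam μ Q 1

/-- `P` is the h-transform measure `P_x⁺`: for every `n` and every bounded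
`F n`-measurable `g`, `E_P[g] = u(x)⁻¹ E_x[g · u(S_n); L_n ≥ 0]`. -/
def IsPplus (μ : Measure Ω) (X : ℕ → Ω → ℝ) (F : ℕ → MeasurableSpace Ω) (x : ℝ)
    (P : Measure Ω) : Prop :=
  IsProbabilityMeasure P ∧
    ∀ (n : ℕ) (g : Ω → ℝ), Measurable[F n] g → (∃ C, ∀ ω, |g ω| ≤ C) →
      ∫ ω, g ω ∂P =
        (uFun μ X x)⁻¹ * ∫ ω in posSet X x n, g ω * uFun μ X (x + walk X n ω) ∂μ

/-- `P` is the h-transform measure `P_x⁻`: for every `n` and every bounded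
`F n`-measurable `g`, `E_P[g] = v(x)⁻¹ E_x[g · v(S_n); M_n < 0]`. -/
def IsPminus (μ : Measure Ω) (X : ℕ → Ω → ℝ) (F : ℕ → MeasurableSpace Ω) (x : ℝ)
    (P : Measure Ω) : Prop :=
  IsProbabilityMeasure P ∧
    ∀ (n : ℕ) (g : Ω → ℝ), Measurable[F n] g → (∃ C, ∀ ω, |g ω| ≤ C) →
      ∫ ω, g ω ∂P =
        (vFun μ X x)⁻¹ * ∫ ω in negSet X x n, g ω * vFun μ X (x + walk X n ω) ∂μ

/-- The filtration generated by the environment `Q 1, ..., Q n`. -/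
def envFiltration {E : Type*} [MeasurableSpace E] (Q : ℕ → Ω → E) (n : ℕ) :
    MeasurableSpace Ω :=
  ⨆ i ∈ Finset.Icc 1 n, MeasurableSpace.comap (Q i) inferInstance

/-- The σ-algebra generated by the whole environment `Q 1, Q 2, ...`. -/
def envSigma {E : Type*} [MeasurableSpace E] (Q : ℕ → Ω → E) : MeasurableSpace Ω :=
  ⨆ i, MeasurableSpace.comap (Q (i + 1)) inferInstance




/-- Probability generating function of the (random) offspring law `Q n`. -/
def pgf (Q : ℕ → Ω → Measure ℕ) (n : ℕ) (ω : Ω) (s : ℝ) : ℝ :=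
  ∑' i : ℕ, (Q n ω {i}).toReal * s ^ i

/-- Mean `m(Q_n)` of the offspring law `Q n`. -/
def meanQ (Q : ℕ → Ω → Measure ℕ) (n : ℕ) (ω : Ω) : ℝ :=
  ∑' i : ℕ, (i : ℝ) * (Q n ω {i}).toReal

/-- `X_n = log f_n'(1)`, the increments of the associated random walk. -/
def Xenv (Q : ℕ → Ω → Measure ℕ) (n : ℕ) (ω : Ω) : ℝ := Real.log (meanQ Q n ω)

/-- `η_n = f_n''(1) / (2 f_n'(1)^2)`. -/
def etaEnv (Q : ℕ → Ω → Measure ℕ) (n : ℕ) (ω : Ω) : ℝ :=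
  (∑' i : ℕ, ((i : ℝ) * ((i : ℝ) - 1)) * (Q n ω {i}).toReal) / (2 * meanQ Q n ω ^ 2)

/-- The associated random walk `S_n = X_1 + ... + X_n`. -/
def Senv (Q : ℕ → Ω → Measure ℕ) : ℕ → Ω → ℝ := walk (Xenv Q)

/-- The composition `f_{j,n}(s) = f_{j+1}(f_{j+2}(⋯ f_n(s) ⋯))`, with `f_{j,n} = id` for
`n ≤ j`. -/
def pgfComp (Q : ℕ → Ω → Measure ℕ) (j : ℕ) : ℕ → Ω → ℝ → ℝ
  | 0, _, s => s
  | n + 1, ω, s => if n + 1 ≤ j then s else pgfComp Q j n ω (pgf Q (n + 1) ω s)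

/-- `b_n = ∑_{i=0}^{n-1} η_{i+1} e^{-S_i}`. -/
def bEnv (Q : ℕ → Ω → Measure ℕ) (n : ℕ) (ω : Ω) : ℝ :=
  ∑ i ∈ Finset.range n, etaEnv Q (i + 1) ω * Real.exp (-(Senv Q i ω))

/-- `B⁺ = ∑_{i=0}^∞ η_{i+1} e^{-S_i}`. -/
def Bplus (Q : ℕ → Ω → Measure ℕ) (ω : Ω) : ℝ :=
  ∑' i : ℕ, etaEnv Q (i + 1) ω * Real.exp (-(Senv Q i ω))

/-- `B⁻ = ∑_{i=1}^∞ η_i e^{S_i}`. -/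
def Bminus (Q : ℕ → Ω → Measure ℕ) (ω : Ω) : ℝ :=
  ∑' i : ℕ, etaEnv Q (i + 1) ω * Real.exp (Senv Q (i + 1) ω)

/-- `V_∞(r) = 1 / (B⁻ + (1 - r)⁻¹)`. -/
def Vinf (Q : ℕ → Ω → Measure ℕ) (r : ℝ) (ω : Ω) : ℝ := (Bminus Q ω + (1 - r)⁻¹)⁻¹

/-- All the offspring generating functions are fractional linear:
`1/(1 - f_n(s)) = e^{-X_n}/(1-s) + η_n`. -/
def FracLinear (Q : ℕ → Ω → Measure ℕ) : Prop :=
  ∀ n, 1 ≤ n → ∀ ω : Ω, ∀ s : ℝ, 0 ≤ s → s < 1 →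
    (1 - pgf Q n ω s)⁻¹ = Real.exp (-(Xenv Q n ω)) / (1 - s) + etaEnv Q n ω

/-- Assumption A1 with explicit constant `χ`. -/
def AssumptionA1With (μ : Measure Ω) (Q : ℕ → Ω → Measure ℕ) (χ : ℝ) : Prop :=
  0 < χ ∧ χ < 1 / 2 ∧ ∀ n, 1 ≤ n →
    ∀ᵐ ω ∂μ, χ ≤ pgf Q n ω 0 ∧ pgf Q n ω 0 ≤ 1 - χ ∧ χ ≤ etaEnv Q n ω

/-- Assumption A1: for some `χ ∈ (0,1/2)`, `χ ≤ f(0) ≤ 1 - χ` and `η ≥ χ` a.s. -/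
def AssumptionA1 (μ : Measure Ω) (Q : ℕ → Ω → Measure ℕ) : Prop :=
  ∃ χ : ℝ, AssumptionA1With μ Q χ

/-- Assumption A2: `X` has zero mean, finite positive variance and is non-lattice. -/
def AssumptionA2 (μ : Measure Ω) (Q : ℕ → Ω → Measure ℕ) : Prop :=
  Integrable (Xenv Q 1) μ ∧ (∫ ω, Xenv Q 1 ω ∂μ) = 0 ∧
    Integrable (fun ω => Xenv Q 1 ω ^ 2) μ ∧ 0 < ∫ ω, Xenv Q 1 ω ^ 2 ∂μ ∧
    NonLattice (μ.map (Xenv Q 1))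

/-- `ζ(a) = ∑_{y ≥ a} y² Q({y}) / m(Q)²`. -/
def zetaEnv (Q : ℕ → Ω → Measure ℕ) (a : ℕ) (ω : Ω) : ℝ :=
  (∑' y : ℕ, if a ≤ y then (y : ℝ) ^ 2 * (Q 1 ω {y}).toReal else 0) / meanQ Q 1 ω ^ 2

/-- Assumption A3: `E[(log⁺ ζ(a))^{2+ε}] < ∞` for some `ε > 0`, `a ∈ ℕ`. -/
def AssumptionA3 (μ : Measure Ω) (Q : ℕ → Ω → Measure ℕ) : Prop :=
  ∃ ε : ℝ, 0 < ε ∧ ∃ a : ℕ, 1 ≤ a ∧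
    Integrable (fun ω => Real.log (max (zetaEnv Q a ω) 1) ^ (2 + ε)) μ

/-- The extinction moment `T = min {k ≥ 0 : Z_k = 0}`. -/
def extinctTime (Z : ℕ → Ω → ℕ) (ω : Ω) : ℕ := sInf {k | Z k ω = 0}

/-- The branching property of `Z` in the environment `Q` (started from one particle):
given the environment and `Z_k`, the conditional generating function of `Z_n` is
`f_{k,n}(s)^{Z_k}`; the state `0` is absorbing. -/
def BranchingProperty (μ : Measure Ω) (Q : ℕ → Ω → Measure ℕ) (Z : ℕ → Ω → ℕ) : Prop :=
  (∀ ω, Z 0 ω = 1) ∧ (∀ n, Measurable (Z n)) ∧ (∀ n ω, Z n ω = 0 → Z (n + 1) ω = 0) ∧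
    ∀ k n : ℕ, k ≤ n → ∀ s : ℝ, 0 ≤ s → s ≤ 1 →
      (μ[fun ω => s ^ Z n ω | envSigma Q ⊔ MeasurableSpace.comap (Z k) inferInstance])
        =ᵐ[μ] fun ω => pgfComp Q k n ω s ^ Z k ω

/-- The event `{-y ≤ S_k, M_k < 0}`, with `M_0 < 0` read as vacuously true. -/
def descentSet (X : ℕ → Ω → ℝ) (k : ℕ) (y : ℝ) : Set Ω :=
  {ω | -y ≤ walk X k ω ∧ ∀ i ∈ Finset.Icc 1 k, walk X i ω < 0}

/-- The event that `k + 1` is the first positive time at which the walk is nonnegative. -/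
def firstAscent (X : ℕ → Ω → ℝ) (k : ℕ) : Set Ω :=
  {ω | 0 ≤ walk X (k + 1) ω ∧ ∀ i ∈ Finset.Icc 1 k, walk X i ω < 0}

/-- The `ℝ≥0∞`-valued version of `uFun`. -/
def renewalMass (μ : Measure Ω) (X : ℕ → Ω → ℝ) (y : ℝ) : ENNReal :=
  ∑' k : ℕ, μ (descentSet X k y)

open Classical in
/-- The value of `S_k` on `{M_k < 0}` and `1` elsewhere. -/
def killedWalk (X : ℕ → Ω → ℝ) (k : ℕ) (ω : Ω) : ℝ :=
  if ∀ i ∈ Finset.Icc 1 k, walk X i ω < 0 then walk X k ω else 1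

lemma walk_zero {α : Type*} (X : ℕ → α → ℝ) (ω : α) : walk X 0 ω = 0 := by simp [walk]

lemma walk_succ {α : Type*} (X : ℕ → α → ℝ) (k : ℕ) (ω : α) :
    walk X (k + 1) ω = walk X k ω + X (k + 1) ω := by
  simp [walk, Finset.sum_Icc_succ_top]

lemma measurable_walk {α : Type*} {m : MeasurableSpace α} {X : ℕ → α → ℝ} {k : ℕ}
    (hX : ∀ i ≤ k, Measurable[m] (X i)) : Measurable[m] (walk X k) := by
  unfold walk
  exact Finset.measurable_fun_sum _ fun i hi => hX i (Finset.mem_Icc.mp hi).2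

lemma walk_nonpos_of_neg {α : Type*} {X : ℕ → α → ℝ} {k : ℕ} {ω : α}
    (h : ∀ i ∈ Finset.Icc 1 k, walk X i ω < 0) : walk X k ω ≤ 0 := by
  rcases k with _ | k
  · simp [walk_zero]
  · exact (h _ (by simp)).le

lemma measurableSet_walk_neg {α : Type*} {m : MeasurableSpace α} {X : ℕ → α → ℝ} {k : ℕ}
    (hX : ∀ i ≤ k, Measurable[m] (X i)) :
    MeasurableSet[m] {ω | ∀ i ∈ Finset.Icc 1 k, walk X i ω < 0} := by
  have : {ω | ∀ i ∈ Finset.Icc 1 k, walk X i ω < 0} =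
      ⋂ i ∈ Finset.Icc 1 k, {ω | walk X i ω < 0} := by ext; simp
  rw [this]
  refine Finset.measurableSet_biInter _ fun i hi => ?_
  have hi' := (Finset.mem_Icc.mp hi).2
  exact measurableSet_lt (measurable_walk fun j hj => hX j (hj.trans hi')) measurable_const

lemma measurable_killedWalk {α : Type*} {m : MeasurableSpace α} {X : ℕ → α → ℝ} {k : ℕ}
    (hX : ∀ i ≤ k, Measurable[m] (X i)) : Measurable[m] (killedWalk X k) := by
  classical
  exact Measurable.ite (measurableSet_walk_neg hX) (measurable_walk hX) measurable_const

lemma killedWalk_nonpos_iff {α : Type*} {X : ℕ → α → ℝ} {k : ℕ} {ω : α} :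
    killedWalk X k ω ≤ 0 ↔ ∀ i ∈ Finset.Icc 1 k, walk X i ω < 0 := by
  unfold killedWalk
  split_ifs with h
  · exact ⟨fun _ => h, fun _ => walk_nonpos_of_neg h⟩
  · exact ⟨fun h' => by norm_num at h', fun h' => absurd h' h⟩

lemma killedWalk_eq_of_neg {α : Type*} {X : ℕ → α → ℝ} {k : ℕ} {ω : α}
    (h : ∀ i ∈ Finset.Icc 1 k, walk X i ω < 0) : killedWalk X k ω = walk X k ω := if_pos h

lemma descentSet_eq_preimage {α : Type*} (X : ℕ → α → ℝ) (k : ℕ) (y : ℝ) :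
    descentSet X k y = killedWalk X k ⁻¹' Icc (-y) 0 := by
  ext ω
  simp only [descentSet, mem_ofPred_eq, mem_preimage, mem_Icc, killedWalk_nonpos_iff]
  exact and_congr_left fun h => by rw [killedWalk_eq_of_neg h]

lemma descentSet_of_neg {α : Type*} (X : ℕ → α → ℝ) (k : ℕ) {y : ℝ} (hy : y < 0) :
    descentSet X k y = ∅ := by
  rw [descentSet_eq_preimage, Icc_eq_empty (by linarith), preimage_empty]

lemma descentSet_zero {α : Type*} (X : ℕ → α → ℝ) {y : ℝ} (hy : 0 ≤ y) :
    descentSet X 0 y = univ := by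
  ext ω
  simp [descentSet, walk_zero, hy]

lemma descentSet_mono {α : Type*} (X : ℕ → α → ℝ) (k : ℕ) : Monotone (descentSet X k) :=
  fun _ _ hab _ h => ⟨(neg_le_neg hab).trans h.1, h.2⟩

lemma renewalMass_mono (μ : Measure Ω) (X : ℕ → Ω → ℝ) : Monotone (renewalMass μ X) :=
  fun _ _ hab => ENNReal.tsum_le_tsum fun k => measure_mono (descentSet_mono X k hab)

lemma renewalMass_of_neg (μ : Measure Ω) (X : ℕ → Ω → ℝ) {y : ℝ} (hy : y < 0) :
    renewalMass μ X y = 0 := by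
  simp [renewalMass, descentSet_of_neg X _ hy]

lemma renewalMass_of_nonneg (μ : Measure Ω) [IsProbabilityMeasure μ] (X : ℕ → Ω → ℝ) {y : ℝ}
    (hy : 0 ≤ y) : renewalMass μ X y = 1 + ∑' k : ℕ, μ (descentSet X (k + 1) y) := by
  rw [renewalMass, tsum_eq_zero_add' ENNReal.summable, descentSet_zero X hy, measure_univ]

lemma renewalMass_zero (μ : Measure Ω) [IsProbabilityMeasure μ] (X : ℕ → Ω → ℝ) :
    renewalMass μ X 0 = 1 := by
  have h (k : ℕ) : descentSet X (k + 1) 0 = ∅ := by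
    refine eq_empty_of_forall_notMem fun ω hω => ?_
    have h1 := hω.1
    have h2 := hω.2 (k + 1) (by simp)
    linarith
  simp [renewalMass_of_nonneg μ X le_rfl, h]

lemma uFun_eq_toReal {μ : Measure Ω} [IsProbabilityMeasure μ] {X : ℕ → Ω → ℝ}
    (hfin : ∀ y, renewalMass μ X y ≠ ⊤) (y : ℝ) : uFun μ X y = (renewalMass μ X y).toReal := by
  unfold uFun
  split_ifs with hy
  · have hset (k : ℕ) : {ω | -walk X (k + 1) ω ≤ y ∧ Mwalk X (k + 1) ω < 0} =
        descentSet X (k + 1) y := by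
      ext ω
      simp only [descentSet, Mwalk, Finset.sup'_lt_iff, mem_ofPred_eq]
      exact and_congr_left fun _ => neg_le
    have h := hfin y
    rw [renewalMass_of_nonneg μ X hy] at h ⊢
    rw [ENNReal.toReal_add ENNReal.one_ne_top (ENNReal.add_ne_top.mp h).2,
      ENNReal.tsum_toReal_eq fun k => measure_ne_top _ _]
    simp [hset]
  · simp [renewalMass_of_neg μ X (not_le.mp hy)]

lemma indepFun_killedWalk {μ : Measure Ω} {X : ℕ → Ω → ℝ} (hiid : IIDseq μ X) (k : ℕ) :
    IndepFun (killedWalk X k) (X (k + 1)) μ := by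
  have hsm (i : ℕ) : StronglyMeasurable (X i) := (hiid.1 i).stronglyMeasurable
  have h := hiid.2.1.indep_comap_natural_of_lt hsm (Nat.lt_succ_self k)
  refine (indep_of_indep_of_le_right h ?_).symm
  refine Measurable.comap_le (measurable_killedWalk fun i hi => ?_)
  exact ((Filtration.stronglyAdapted_natural hsm i).measurable).mono
    ((Filtration.natural X hsm).mono hi) le_rfl

lemma lintegral_descentSet {μ : Measure Ω} [IsProbabilityMeasure μ] {X : ℕ → Ω → ℝ}
    (hiid : IIDseq μ X) (k : ℕ) (x : ℝ) :
    ∫⁻ ω, μ (descentSet X k (x + X 1 ω)) ∂μ =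
      μ {ω | -x ≤ walk X (k + 1) ω ∧ ∀ i ∈ Finset.Icc 1 k, walk X i ω < 0} := by
  have hV : Measurable (killedWalk X k) := measurable_killedWalk fun i _ => hiid.1 i
  have hY := hiid.1 (k + 1)
  set A : Set (ℝ × ℝ) := {p | -x ≤ p.1 + p.2 ∧ p.1 ≤ 0} with hA
  have hAm : MeasurableSet A :=
    (measurableSet_le measurable_const (measurable_fst.add measurable_snd)).inter
      (measurableSet_le measurable_fst measurable_const)
  have hset : {ω | -x ≤ walk X (k + 1) ω ∧ ∀ i ∈ Finset.Icc 1 k, walk X i ω < 0} =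
      (fun ω => (killedWalk X k ω, X (k + 1) ω)) ⁻¹' A := by
    ext ω
    simp only [hA, mem_ofPred_eq, mem_preimage, killedWalk_nonpos_iff, walk_succ]
    exact and_congr_left fun h => by rw [killedWalk_eq_of_neg h]
  have hsec (t : ℝ) : μ.map (killedWalk X k) ((fun v => (v, t)) ⁻¹' A) =
      μ (descentSet X k (x + t)) := by
    rw [Measure.map_apply hV (hAm.preimage (by fun_prop)), descentSet_eq_preimage]
    congr 1
    ext ω
    simp only [hA, mem_preimage, mem_ofPred_eq, mem_Icc]
    exact and_congr_left fun _ => ⟨fun h => by linarith, fun h => by linarith⟩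
  have hmono : Monotone fun t => μ (descentSet X k (x + t)) :=
    fun a b hab => measure_mono (descentSet_mono X k (by linarith))
  rw [hset, ← Measure.map_apply (hV.prodMk hY) hAm,
    (indepFun_iff_map_prod_eq_prod_map_map hV.aemeasurable hY.aemeasurable).mp
      (indepFun_killedWalk hiid k), Measure.prod_apply_symm hAm]
  simp_rw [hsec]
  rw [(hiid.2.2 (k + 1)).map_eq, lintegral_map hmono.measurable (hiid.1 1)]

lemma measure_walk_succ_ge {μ : Measure Ω} {X : ℕ → Ω → ℝ} (hX : ∀ i, Measurable (X i))
    (k : ℕ) {x : ℝ} (hx : 0 ≤ x) :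
    μ {ω | -x ≤ walk X (k + 1) ω ∧ ∀ i ∈ Finset.Icc 1 k, walk X i ω < 0} =
      μ (descentSet X (k + 1) x) + μ (firstAscent X k) := by
  have hm : MeasurableSet (firstAscent X k) :=
    (measurableSet_le measurable_const (measurable_walk fun i _ => hX i)).inter
      (measurableSet_walk_neg fun i _ => hX i)
  rw [← measure_union _ hm]
  · congr 1
    ext ω
    simp only [descentSet, firstAscent, mem_union, mem_ofPred_eq]
    constructor
    · rintro ⟨h1, h2⟩
      rcases lt_or_ge (walk X (k + 1) ω) 0 with h | h
      · refine Or.inl ⟨h1, fun i hi => ?_⟩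
        rw [Finset.mem_Icc] at hi
        rcases hi.2.eq_or_lt with rfl | hlt
        · exact h
        · exact h2 i (Finset.mem_Icc.mpr ⟨hi.1, by omega⟩)
      · exact Or.inr ⟨h, h2⟩
    · rintro (⟨h1, h2⟩ | ⟨h1, h2⟩)
      · exact ⟨h1, fun i hi => h2 i (Finset.Icc_subset_Icc_right k.le_succ hi)⟩
      · exact ⟨by linarith, h2⟩
  · refine disjoint_left.mpr fun ω h1 h2 => ?_
    have := h1.2 (k + 1) (by simp)
    exact absurd h2.1 (not_le.mpr this)

lemma tsum_measure_firstAscent {μ : Measure Ω} [IsProbabilityMeasure μ] {X : ℕ → Ω → ℝ}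
    (hX : ∀ i, Measurable (X i)) (hpos : ∀ᵐ ω ∂μ, ∃ n, 0 < walk X n ω) :
    ∑' k : ℕ, μ (firstAscent X k) = 1 := by
  have hm (k : ℕ) : MeasurableSet (firstAscent X k) :=
    (measurableSet_le measurable_const (measurable_walk fun i _ => hX i)).inter
      (measurableSet_walk_neg fun i _ => hX i)
  have hdisj : Pairwise (Function.onFun Disjoint (firstAscent X)) := by
    refine (pairwise_disjoint_on _).mpr fun a b hab => disjoint_left.mpr fun ω h1 h2 => ?_
    exact absurd h1.1 (not_le.mpr (h2.2 (a + 1) (Finset.mem_Icc.mpr ⟨by omega, by omega⟩)))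
  rw [← measure_iUnion hdisj hm, prob_compl_eq_zero_iff (MeasurableSet.iUnion hm) |>.mp]
  rw [← mem_ae_iff]
  filter_upwards [hpos] with ω ⟨n, hn⟩
  classical
  have hex : ∃ k, 0 ≤ walk X (k + 1) ω := by
    rcases n with _ | n
    · simp [walk_zero] at hn
    · exact ⟨n, hn.le⟩
  refine mem_iUnion.mpr ⟨Nat.find hex, Nat.find_spec hex, fun i hi => ?_⟩
  rw [Finset.mem_Icc] at hi
  have h := Nat.find_min hex (m := i - 1) (by omega)
  rw [Nat.sub_add_cancel hi.1] at h
  exact not_le.mp h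

lemma lintegral_renewalMass {μ : Measure Ω} [IsProbabilityMeasure μ] {X : ℕ → Ω → ℝ}
    (hiid : IIDseq μ X) (hpos : ∀ᵐ ω ∂μ, ∃ n, 0 < walk X n ω) {x : ℝ} (hx : 0 ≤ x) :
    ∫⁻ ω, renewalMass μ X (x + X 1 ω) ∂μ = renewalMass μ X x := by
  have hmeas (k : ℕ) : Measurable fun ω => μ (descentSet X k (x + X 1 ω)) := by
    have hmono : Monotone fun t => μ (descentSet X k t) :=
      fun a b hab => measure_mono (descentSet_mono X k hab)
    exact hmono.measurable.comp ((hiid.1 1).const_add x)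
  simp_rw [renewalMass]
  rw [lintegral_tsum fun k => (hmeas k).aemeasurable]
  simp_rw [lintegral_descentSet hiid, measure_walk_succ_ge hiid.1 _ hx]
  rw [ENNReal.tsum_add, tsum_measure_firstAscent hiid.1 hpos, ← renewalMass,
    renewalMass_of_nonneg μ X hx, add_comm]

lemma exists_measure_increment_ge_pos {μ : Measure Ω} [IsProbabilityMeasure μ] {X : ℕ → Ω → ℝ}
    (hiid : IIDseq μ X) (hpos : ∀ᵐ ω ∂μ, ∃ n, 0 < walk X n ω) :
    ∃ δ > 0, μ {ω | δ ≤ X 1 ω} ≠ 0 := by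
  by_contra! h
  have h1 : ∀ᵐ ω ∂μ, X 1 ω ≤ 0 := by
    have : ∀ᵐ ω ∂μ, ∀ n : ℕ, X 1 ω < 1 / ((n : ℝ) + 1) := by
      refine ae_all_iff.mpr fun n => ?_
      simpa [ae_iff] using h (1 / ((n : ℝ) + 1)) (by positivity)
    filter_upwards [this] with ω hω
    by_contra! hlt
    obtain ⟨n, hn⟩ := exists_nat_one_div_lt hlt
    exact absurd (hω n) (not_lt.mpr hn.le)
  have hall : ∀ᵐ ω ∂μ, ∀ i, X i ω ≤ 0 :=
    ae_all_iff.mpr fun i => (hiid.2.2 i).symm.ae_snd (p := fun t => t ≤ 0) measurableSet_Iic h1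
  obtain ⟨ω, ⟨n, hn⟩, hω⟩ := (hpos.and hall).exists
  exact absurd hn (not_lt.mpr (Finset.sum_nonpos fun i _ => hω i))

lemma renewalMass_ne_top {μ : Measure Ω} [IsProbabilityMeasure μ] {X : ℕ → Ω → ℝ}
    (hiid : IIDseq μ X) (hpos : ∀ᵐ ω ∂μ, ∃ n, 0 < walk X n ω) (y : ℝ) :
    renewalMass μ X y ≠ ⊤ := by
  obtain ⟨δ, hδ, hprob⟩ := exists_measure_increment_ge_pos hiid hpos
  have hnat (n : ℕ) : renewalMass μ X (n * δ) ≠ ⊤ := by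
    induction n with
    | zero => simp [renewalMass_zero]
    | succ n ih =>
      have hmeas : Measurable fun ω => renewalMass μ X (n * δ + X 1 ω) :=
        (renewalMass_mono μ X).measurable.comp ((hiid.1 1).const_add _)
      rw [← lintegral_renewalMass hiid hpos (by positivity)] at ih
      have hae := ae_lt_top hmeas ih
      obtain ⟨ω, hω, hfin⟩ := ((frequently_ae_iff.mpr hprob).and_eventually hae).exists
      refine ne_top_of_le_ne_top hfin.ne (renewalMass_mono μ X ?_)
      push_cast
      linarith
  obtain ⟨n, hn⟩ := exists_nat_ge (y / δ)
  exact ne_top_of_le_ne_top (hnat n) (renewalMass_mono μ X ((div_le_iff₀ hδ).mp hn))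

/-- **Harmonicity of `u`.** For an oscillating random walk with i.i.d. increments,
the function `u(x) = 1 + ∑_{k≥1} P(-S_k ≤ x, M_k < 0)` satisfies
`E[u(x + X); x + X ≥ 0] = u(x)` for all `x ≥ 0`. -/
theorem statement4
    {Ω : Type*} [MeasurableSpace Ω] (μ : Measure Ω) [IsProbabilityMeasure μ]
    (X : ℕ → Ω → ℝ) (hiid : IIDseq μ X)
    (hosc : ∀ᵐ ω ∂μ, (∀ C : ℝ, ∃ n, C < walk X n ω) ∧ (∀ C : ℝ, ∃ n, walk X n ω < C)) :
    ∀ x : ℝ, 0 ≤ x →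
      ∫ ω in {ω | 0 ≤ x + X 1 ω}, uFun μ X (x + X 1 ω) ∂μ = uFun μ X x := by
  intro x hx
  have hpos : ∀ᵐ ω ∂μ, ∃ n, 0 < walk X n ω := hosc.mono fun ω h => h.1 0
  have hfin := renewalMass_ne_top hiid hpos
  have hX := hiid.1 1
  have hmeas : Measurable fun ω => renewalMass μ X (x + X 1 ω) :=
    (renewalMass_mono μ X).measurable.comp (hX.const_add x)
  have hzero : ∀ ω, ω ∉ {ω | 0 ≤ x + X 1 ω} → uFun μ X (x + X 1 ω) = 0 := fun ω hω => if_neg hω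
  rw [setIntegral_eq_integral_of_forall_compl_eq_zero hzero]
  simp_rw [uFun_eq_toReal hfin]
  rw [integral_toReal hmeas.aemeasurable (ae_of_all _ fun ω => (hfin _).lt_top),
    lintegral_renewalMass hiid hpos hx]

end BPREpaper
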